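/- Let v ∈ ℝ^m have strictly positive entries, S ∈ ℝ^{1×n₁}, T ∈ ℝ^{m×n₂}, and let A = [S ⊗ v T] ∈ ℝ^{m×(n₁+n₂)}, whose i-th row is the concatenation of v[i]·S and T[i,:]. For i ∈ {2,…,m} let R_i = Giv_m(1, i, −v[i]/‖v[1..i]‖, ‖v[1..i−1]‖/‖v[1..i]‖) and G = R_m ⋯ R_2. Then G·A equals the block matrix with first row [‖v‖·S H(T, v)] and remaining m−1 rows [0^{(m−1)×n₁} T(T, v)]. -/

import Mathlib

open Matrix

/-- The head `H(A)` of a matrix `A ∈ ℝ^{m×n}`: the row `(1/√m) ∑_{i=1}^m A[i,:]`. -/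
noncomputable def headM {m n : ℕ} (A : Matrix (Fin m) (Fin n) ℝ) : Fin n → ℝ :=
  fun c => (1 / Real.sqrt m) * ∑ i, A i c

/-- The tail `T(A)` of a matrix `A ∈ ℝ^{m×n}`: for (1-based) `j ∈ [m-1]`, its `j`-th row is
`(1/√(j+1)) (√j · A[j+1,:] − (∑_{i=1}^j A[i,:])/√j)`. Rows are 0-indexed, so the row of
index `j : Fin (m-1)` corresponds to the 1-based index `j+1`. -/
noncomputable def tailM {m n : ℕ} (A : Matrix (Fin m) (Fin n) ℝ) :
    Matrix (Fin (m - 1)) (Fin n) ℝ :=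
  fun j c =>
    (1 / Real.sqrt ((j.val : ℝ) + 2)) *
      (Real.sqrt ((j.val : ℝ) + 1) * A ⟨j.val + 1, by have := j.isLt; omega⟩ c -
        (∑ i ∈ Finset.univ.filter (fun i : Fin m => i.val < j.val + 1), A i c) /
          Real.sqrt ((j.val : ℝ) + 1))

/-- `pnorm v j` is the ℓ2 norm of the first `j` entries of `v`, i.e. `‖v[1..j]‖`.
In particular `pnorm v m = ‖v‖`. -/
noncomputable def pnorm {m : ℕ} (v : Fin m → ℝ) (j : ℕ) : ℝ :=
  Real.sqrt (∑ i ∈ Finset.univ.filter (fun i : Fin m => i.val < j), v i ^ 2)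

/-- The generalized head `H(A, v) = (1/‖v‖) ∑_{i=1}^m v[i] · A[i,:]`. -/
noncomputable def gHead {m n : ℕ} (A : Matrix (Fin m) (Fin n) ℝ) (v : Fin m → ℝ) :
    Fin n → ℝ :=
  fun c => (1 / pnorm v m) * ∑ i, v i * A i c

/-- The generalized tail `T(A, v)`: for (1-based) `j ∈ [m-1]`, its `j`-th row is
`(1/‖v[1..j+1]‖)(‖v[1..j]‖ · A[j+1,:] − v[j+1] · (∑_{i=1}^j v[i] A[i,:])/‖v[1..j]‖)`. -/
noncomputable def gTail {m n : ℕ} (A : Matrix (Fin m) (Fin n) ℝ) (v : Fin m → ℝ) :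
    Matrix (Fin (m - 1)) (Fin n) ℝ :=
  fun j c =>
    (1 / pnorm v (j.val + 2)) *
      (pnorm v (j.val + 1) * A ⟨j.val + 1, by have := j.isLt; omega⟩ c -
        v ⟨j.val + 1, by have := j.isLt; omega⟩ *
          (∑ i ∈ Finset.univ.filter (fun i : Fin m => i.val < j.val + 1), v i * A i c) /
          pnorm v (j.val + 1))

/-- The `d`-dimensional Givens rotation matrix `Giv_d(i, j, s, c)`. -/
noncomputable def Givens (d : ℕ) (i j : Fin d) (s c : ℝ) : Matrix (Fin d) (Fin d) ℝ :=
  fun k l =>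
    if k = i ∧ l = i then c
    else if k = j ∧ l = j then c
    else if k = i ∧ l = j then -s
    else if k = j ∧ l = i then s
    else if k = l then 1 else 0

theorem Givens_mul_apply {d : ℕ} {n : Type*} {i j : Fin d} (hij : i ≠ j) (s c : ℝ)
    (A : Matrix (Fin d) n ℝ) (k : Fin d) (l : n) :
    (Givens d i j s c * A) k l =
      if k = i then c * A i l - s * A j l
      else if k = j then s * A i l + c * A j l
      else A k l := by
  rw [Matrix.mul_apply]
  split_ifs with hi hj
  · subst hi
    have h : ∀ x, Givens d k j s c k x * A x l =
        (if x = k then c * A x l else 0) + (if x = j then -s * A x l else 0) := by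
      intro x
      by_cases h1 : x = k <;> by_cases h2 : x = j <;>
        simp_all [Givens, eq_comm]
    simp [h, Finset.sum_add_distrib, sub_eq_add_neg]
  · subst hj
    have h : ∀ x, Givens d i k s c k x * A x l =
        (if x = i then s * A x l else 0) + (if x = k then c * A x l else 0) := by
      intro x
      by_cases h1 : x = i <;> by_cases h2 : x = k <;>
        simp_all [Givens, eq_comm]
    simp [h, Finset.sum_add_distrib]
  · simp [Givens, hi, hj]

theorem sum_filter_val_lt_succ {m : ℕ} (f : Fin m → ℝ) {k : ℕ} (hk : k < m) :
    ∑ i ∈ Finset.univ.filter (fun i : Fin m => i.val < k + 1), f i =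
      ∑ i ∈ Finset.univ.filter (fun i : Fin m => i.val < k), f i + f ⟨k, hk⟩ := by
  have h : Finset.univ.filter (fun i : Fin m => i.val < k + 1) =
      insert ⟨k, hk⟩ (Finset.univ.filter (fun i : Fin m => i.val < k)) := by
    ext i
    simp only [Finset.mem_filter, Finset.mem_univ, true_and, Finset.mem_insert, Fin.ext_iff]
    omega
  rw [h, Finset.sum_insert (by simp), add_comm]

theorem pnorm_sq {m : ℕ} (v : Fin m → ℝ) (j : ℕ) :
    pnorm v j ^ 2 = ∑ i ∈ Finset.univ.filter (fun i : Fin m => i.val < j), v i ^ 2 :=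
  Real.sq_sqrt (Finset.sum_nonneg fun _ _ => sq_nonneg _)

theorem pnorm_succ_pos {m : ℕ} (hm : 0 < m) {v : Fin m → ℝ} (hv : ∀ i, 0 < v i) (j : ℕ) :
    0 < pnorm v (j + 1) :=
  Real.sqrt_pos.2 <| Finset.sum_pos (fun i _ => pow_pos (hv i) 2) ⟨⟨0, hm⟩, by simp⟩

theorem pnorm_one {m : ℕ} (hm : 0 < m) {v : Fin m → ℝ} (hv : ∀ i, 0 < v i) :
    pnorm v 1 = v ⟨0, hm⟩ := by
  have h := sum_filter_val_lt_succ (fun i => v i ^ 2) hm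
  simp only [zero_add, not_lt_zero, Finset.filter_false, Finset.sum_empty] at h
  rw [pnorm, h, Real.sqrt_sq (hv _).le]

/-- After the first `k` rotations, row `0` is the generalized head of the first `k + 1` rows,
rows `1, …, k` are rows of the generalized tail, and the other rows are unchanged. -/
theorem givens_partial_prod_mul_apply {m : ℕ} {n : Type*} (hm : 0 < m)
    {v : Fin m → ℝ} (hv : ∀ i, 0 < v i) (A : Matrix (Fin m) n ℝ)
    (R : Fin (m - 1) → Matrix (Fin m) (Fin m) ℝ)
    (hR : ∀ t, R t = Givens m ⟨0, hm⟩ ⟨t.val + 1, by have := t.isLt; omega⟩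
      (-(v ⟨t.val + 1, by have := t.isLt; omega⟩ / pnorm v (t.val + 2)))
      (pnorm v (t.val + 1) / pnorm v (t.val + 2)))
    (c : n) (k : ℕ) (hk : k ≤ m - 1) (i : Fin m) :
    (((List.ofFn R).take k).reverse.prod * A) i c =
      if i.val = 0 then
        (1 / pnorm v (k + 1)) *
          ∑ r ∈ Finset.univ.filter (fun r : Fin m => r.val < k + 1), v r * A r c
      else if i.val ≤ k then
        (1 / pnorm v (i.val + 1)) * (pnorm v i.val * A i c - v i *
          (∑ r ∈ Finset.univ.filter (fun r : Fin m => r.val < i.val), v r * A r c) /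
            pnorm v i.val)
      else A i c := by
  induction k generalizing i with
  | zero =>
    have h0 := (hv ⟨0, hm⟩).ne'
    rw [List.take_zero, List.reverse_nil, List.prod_nil, Matrix.one_mul]
    split_ifs with hi hi'
    · obtain rfl : i = ⟨0, hm⟩ := Fin.ext hi
      rw [zero_add, pnorm_one hm hv, ← zero_add 1, sum_filter_val_lt_succ _ hm]
      simp [h0]
    · omega
    · rfl
  | succ k ih =>
    have hk' : k < m - 1 := hk
    have hlen : k < (List.ofFn R).length := by simpa using hk'
    have ih := ih hk'.le
    rw [← List.take_append_getElem hlen, List.reverse_append, List.reverse_singleton,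
      List.singleton_append, List.prod_cons, Matrix.mul_assoc, List.getElem_ofFn, hR,
      Givens_mul_apply (by simp [Fin.ext_iff]), ih, ih, ih]
    have hp := (pnorm_succ_pos hm hv k).ne'
    have hq := (pnorm_succ_pos hm hv (k + 1)).ne'
    have hkm : k + 1 < m := by omega
    simp only [Fin.ext_iff, if_true, Nat.add_eq_zero_iff, one_ne_zero, and_false, if_false,
      add_le_iff_nonpos_right, nonpos_iff_eq_zero]
    split_ifs with h1 h2
    · rw [sum_filter_val_lt_succ _ hkm]
      field_simp
      ring
    · obtain rfl : i = ⟨k + 1, hkm⟩ := Fin.ext h2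
      simp only
      field_simp
      ring
    all_goals first | rfl | omega

/-- Lemma 2: applying the Givens rotations `R_m ⋯ R_2` to `A = [S ⊗ v, T]`
(whose `i`-th row is `v[i]·S` concatenated with `T[i,:]`) yields the block matrix
`[‖v‖·S, H(T,v); 0, T(T,v)]`. The rotation for 1-based index `i ∈ {2,…,m}` is indexed
by `t : Fin (m-1)` with `i = t+2`. -/
theorem givens_scaled_cartesian_product {m n₁ n₂ : ℕ} (hm : 2 ≤ m)
    (v : Fin m → ℝ) (hv : ∀ i, 0 < v i)
    (S : Matrix (Fin 1) (Fin n₁) ℝ) (T : Matrix (Fin m) (Fin n₂) ℝ)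
    (A : Matrix (Fin m) (Fin n₁ ⊕ Fin n₂) ℝ)
    (hA : ∀ i c, A i c = Sum.elim (fun c₁ => v i * S 0 c₁) (fun c₂ => T i c₂) c)
    (R : Fin (m - 1) → Matrix (Fin m) (Fin m) ℝ)
    (hR : ∀ t, R t = Givens m ⟨0, by omega⟩ ⟨t.val + 1, by have := t.isLt; omega⟩
      (-(v ⟨t.val + 1, by have := t.isLt; omega⟩ / pnorm v (t.val + 2)))
      (pnorm v (t.val + 1) / pnorm v (t.val + 2)))
    (G : Matrix (Fin m) (Fin m) ℝ)
    (hG : G = ((List.ofFn R).reverse).prod) :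
    ∀ i c, (G * A) i c =
      if i.val = 0 then
        Sum.elim (fun c₁ => pnorm v m * S 0 c₁) (fun c₂ => gHead T v c₂) c
      else
        Sum.elim (fun _ => (0 : ℝ))
          (fun c₂ => gTail T v ⟨i.val - 1, by have := i.isLt; omega⟩ c₂) c := by
  intro i c
  have hG' : G = ((List.ofFn R).take (m - 1)).reverse.prod := by
    rw [hG, List.take_of_length_le (by simp)]
  rw [hG', givens_partial_prod_mul_apply (by omega) hv A R hR c (m - 1) le_rfl i,
    Nat.sub_add_cancel (by omega : 1 ≤ m)]
  have hsum : ∀ (j : ℕ) (s : ℝ),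
      ∑ r ∈ Finset.univ.filter (fun r : Fin m => r.val < j), v r * (v r * s) =
        pnorm v j ^ 2 * s := by
    intro j s
    rw [pnorm_sq, Finset.sum_mul]
    exact Finset.sum_congr rfl fun r _ => by ring
  split_ifs with h0 h1
  · cases c with
    | inl c =>
      have hp := (pnorm_succ_pos (by omega : 0 < m) hv (m - 1)).ne'
      rw [Nat.sub_add_cancel (by omega : 1 ≤ m)] at hp
      simp only [hA, Sum.elim_inl, hsum]
      field_simp
    | inr c => simp [hA, gHead]
  · obtain ⟨_ | j, hj⟩ := i
    · exact absurd rfl h0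
    cases c with
    | inl c =>
      have hp := (pnorm_succ_pos (by omega : 0 < m) hv j).ne'
      simp only [hA, Sum.elim_inl, hsum]
      field_simp
      ring
    | inr c => simp [hA, gTail]
  · omega
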